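/- A nonerasing endomorphism f of A* preserves the LSP property for infinite words over A if and only if f belongs to 𝓛* Perm ∪ P_LSP(A,A), i.e., f is a composition L_{α_1} ∘ ⋯ ∘ L_{α_n} ∘ π with n ≥ 0, letters α_1, …, α_n and π a permutation morphism of A, or f belongs to P_LSP(A,A). -/

import Mathlib

section LSPDefs

variable {A : Type*} {B : Type*}

/-- `u` is a prefix of the infinite word `w`. -/
def IsPrefixI (u : List A) (w : ℕ → A) : Prop :=
  ∀ (i : ℕ) (h : i < u.length), u.get ⟨i, h⟩ = w i

/-- `u` is a factor of the infinite word `w`. -/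
def IsFactorI (u : List A) (w : ℕ → A) : Prop :=
  ∃ k : ℕ, ∀ (i : ℕ) (h : i < u.length), u.get ⟨i, h⟩ = w (k + i)

/-- `u` is a left special factor of the infinite word `w`. -/
def LeftSpecialI (u : List A) (w : ℕ → A) : Prop :=
  ∃ a b : A, a ≠ b ∧ IsFactorI (a :: u) w ∧ IsFactorI (b :: u) w

/-- An infinite word is LSP if all its left special factors are prefixes of it. -/
def IsLSP (w : ℕ → A) : Prop :=
  ∀ u : List A, LeftSpecialI u w → IsPrefixI u w

/-- Application of a morphism (given by images of letters) to a finite word. -/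
def applyM (f : A → List B) (u : List A) : List B := (u.map f).flatten

/-- The prefix of length `n` of an infinite word. -/
def infPrefix (w : ℕ → A) (n : ℕ) : List A := List.ofFn (fun i : Fin n => w i)

/-- `x` is the image of the infinite word `w` under the morphism `f`. -/
def InfImage (f : A → List B) (w : ℕ → A) (x : ℕ → B) : Prop :=
  ∀ n : ℕ, IsPrefixI (applyM f (infPrefix w n)) x

/-- `f` is a basic LSP (bLSP) endomorphism. -/
def IsBLSP (f : A → List A) : Prop :=
  ∃ α : A, f α = [α] ∧ ∀ β : A, β ≠ α → ∃ γ : A, f β = f γ ++ [β]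

/-- `f` is an R-bLSP morphism with domain alphabet `D`: the restriction to `D` of a
bLSP morphism `g` (letters outside the domain are sent to `[]`). -/
def IsRBLSPOn (D : Set A) (f : A → List A) : Prop :=
  (∀ x : A, x ∈ D ↔ f x ≠ []) ∧ ∃ g : A → List A, IsBLSP g ∧ ∀ x ∈ D, f x = g x

/-- The episturmian morphism `L_α`. -/
def Lmor [DecidableEq A] (α : A) : A → List A := fun β => if β = α then [α] else [α, β]

/-- `u` is an `(a,b,c,β,γ)`-fragility of `w`. -/
def Frag5 (w : ℕ → A) (a b c β γ : A) (u : List A) : Prop :=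
  IsPrefixI (u ++ [a]) w ∧ IsFactorI (β :: (u ++ [b])) w ∧ IsFactorI (γ :: (u ++ [c])) w

/-- `w` is `(a,b,c)`-fragile. -/
def Fragile (w : ℕ → A) (a b c : A) : Prop :=
  ∃ (u : List A) (β γ : A), β ≠ γ ∧ Frag5 w a b c β γ u

/-- `f` is LSP `(a,b,c)`-breaking (for words over the domain `D` of `f`). -/
def Breaking (D : Set A) (f : A → List A) (a b c : A) : Prop :=
  ∀ (w x : ℕ → A), Set.range w ⊆ D → IsLSP w → Fragile w a b c →
    InfImage f w x → ¬ IsLSP x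

/-- Length of the longest common prefix of two finite words. -/
noncomputable def lcpLen (u v : List A) : ℕ :=
  sSup {n | n ≤ u.length ∧ n ≤ v.length ∧ u.take n = v.take n}

/-- A morphism is nonerasing if images of letters are nonempty. -/
def Nonerasing (f : A → List B) : Prop := ∀ a : A, f a ≠ []

/-- `f` preserves the LSP property for infinite words. -/
def PreservesLSP (f : A → List B) : Prop :=
  ∀ (w : ℕ → A) (x : ℕ → B), IsLSP w → InfImage f w x → IsLSP x

/-- `f ∈ U(A,B)`: nonerasing and each letter of `B` occurs at most once in total
among the images of letters. -/
def InU [Fintype A] [DecidableEq B] (f : A → List B) : Prop :=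
  Nonerasing f ∧ ∀ b : B, (∑ a : A, (f a).count b) ≤ 1

/-- `u^k`. -/
def listPow (u : List B) (k : ℕ) : List B := (List.replicate k u).flatten

/-- `x = u^ω`. -/
def IsOmegaPow (u : List B) (x : ℕ → B) : Prop := ∀ k : ℕ, IsPrefixI (listPow u k) x

/-- `f ∈ P_LSP(A,B)`: nonerasing, all images are positive powers of a word `u`
with `u^ω` LSP. -/
def InPLSP (f : A → List B) : Prop :=
  Nonerasing f ∧ ∃ u : List B, u ≠ [] ∧ (∀ a : A, ∃ k : ℕ, 0 < k ∧ f a = listPow u k) ∧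
    ∀ x : ℕ → B, IsOmegaPow u x → IsLSP x

/-- `r` is the primitive root of `w`. -/
def IsPrimRoot (r w : List B) : Prop :=
  (∃ k : ℕ, 0 < k ∧ w = listPow r k) ∧
  ∀ (v : List B) (k : ℕ), 0 < k → w = listPow v k → r.length ≤ v.length

/-- Compatibility of a chain of morphisms `[g_1, …, g_n]` (composition
`g_1 ∘ ⋯ ∘ g_n`): every letter produced by `g_{i+1}` lies in the domain of `g_i`. -/
def CompatChain (L : List (B → List B)) : Prop :=
  List.Chain' (fun g h => ∀ x y, y ∈ h x → g y ≠ []) L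

end LSPDefs
set_option linter.unusedSectionVars false
set_option linter.unusedSimpArgs false
set_option linter.unusedVariables false

theorem infPrefix_length {A : Type*} (w : ℕ → A) (n : ℕ) : (infPrefix w n).length = n := by
  simp [infPrefix]

theorem infPrefix_getElem {A : Type*} (w : ℕ → A) (n i : ℕ) (h : i < (infPrefix w n).length) :
    (infPrefix w n)[i] = w i := by
  simp [infPrefix]

theorem infPrefix_succ {A : Type*} (w : ℕ → A) (n : ℕ) :
    infPrefix w (n+1) = infPrefix w n ++ [w n] := by
  unfold infPrefix
  rw [List.ofFn_succ_last]
  simp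

theorem infPrefix_mono {A : Type*} (w : ℕ → A) {m n : ℕ} (h : m ≤ n) :
    infPrefix w m <+: infPrefix w n := by
  induction n, h using Nat.le_induction with
  | base => exact List.prefix_rfl
  | succ n _ ih => rw [infPrefix_succ]; exact ih.trans (List.prefix_append _ _)

theorem infPrefix_add {A : Type*} (w : ℕ → A) (k n : ℕ) :
    infPrefix w (k + n) = infPrefix w k ++ infPrefix (fun i => w (k + i)) n := by
  induction n with
  | zero => simp [infPrefix]
  | succ n ih => rw [← Nat.add_assoc, infPrefix_succ, ih, infPrefix_succ]; simp

theorem prefI_iff {A : Type*} (u : List A) (w : ℕ → A) :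
    IsPrefixI u w ↔ u = infPrefix w u.length := by
  constructor
  · intro h
    apply List.ext_getElem
    · simp [infPrefix]
    · intro i h1 h2
      rw [infPrefix_getElem]
      exact h i h1
  · intro h i hi
    have : (infPrefix w u.length)[i]'(by simpa [infPrefix] using hi) = w i :=
      infPrefix_getElem _ _ _ _
    rw [← this]
    simp only [List.get_eq_getElem]
    congr 1

theorem prefI_infPrefix {A : Type*} (w : ℕ → A) (n : ℕ) : IsPrefixI (infPrefix w n) w := by
  rw [prefI_iff, infPrefix_length]

theorem prefI_of_prefix {A : Type*} {u v : List A} {w : ℕ → A} (h : u <+: v)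
    (hv : IsPrefixI v w) : IsPrefixI u w := by
  intro i hi
  have := hv i (hi.trans_le h.length_le)
  rw [← this]
  simp only [List.get_eq_getElem]
  exact h.getElem hi

theorem prefix_of_prefI {A : Type*} {u v : List A} {w : ℕ → A} (hu : IsPrefixI u w)
    (hv : IsPrefixI v w) (h : u.length ≤ v.length) : u <+: v := by
  rw [prefI_iff] at hu hv
  rw [hu, hv]
  exact infPrefix_mono w h

theorem factI_iff {A : Type*} (u : List A) (w : ℕ → A) :
    IsFactorI u w ↔ ∃ n, u <:+: infPrefix w n := by
  constructor
  · rintro ⟨k, hk⟩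
    have hk' : IsPrefixI u (fun i => w (k+i)) := hk
    rw [prefI_iff] at hk'
    refine ⟨k + u.length, infPrefix w k, [], ?_⟩
    rw [infPrefix_add, ← hk']; simp
  · rintro ⟨n, s, t, h⟩
    refine ⟨s.length, ?_⟩
    intro i hi
    have h1 : IsPrefixI (s ++ u ++ t) w := h ▸ prefI_infPrefix w n
    have h2 := h1 (s.length + i) (by simp; omega)
    rw [← h2]
    simp [List.getElem_append, hi]

theorem factI_of_infix {A : Type*} {u v : List A} {w : ℕ → A} (h : u <:+: v)
    (hv : IsFactorI v w) : IsFactorI u w := by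
  rw [factI_iff] at *
  obtain ⟨n, hn⟩ := hv
  exact ⟨n, h.trans hn⟩

theorem prefI_factI {A : Type*} {u : List A} {w : ℕ → A} (h : IsPrefixI u w) : IsFactorI u w :=
  ⟨0, fun i hi => by rw [Nat.zero_add]; exact h i hi⟩

theorem factI_extend {A : Type*} {u : List A} {w : ℕ → A} (h : IsFactorI u w) :
    ∃ c, IsFactorI (u ++ [c]) w := by
  obtain ⟨k, hk⟩ := h
  refine ⟨w (k + u.length), k, ?_⟩
  have hk' : IsPrefixI u (fun i => w (k+i)) := hk
  rw [prefI_iff] at hk'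
  show IsPrefixI _ (fun i => w (k+i))
  rw [prefI_iff]
  simp only [List.length_append, List.length_singleton]
  rw [infPrefix_succ, ← hk']

theorem prefI_extend {A : Type*} {u : List A} {w : ℕ → A} (h : IsPrefixI u w) :
    ∃ c, IsPrefixI (u ++ [c]) w := by
  refine ⟨w (u.length), ?_⟩
  rw [prefI_iff] at *
  simp only [List.length_append, List.length_singleton]
  rw [infPrefix_succ, ← h]

theorem applyM_append {A B : Type*} (f : A → List B) (u v : List A) :
    applyM f (u ++ v) = applyM f u ++ applyM f v := by simp [applyM]

theorem applyM_cons {A B : Type*} (f : A → List B) (a : A) (v : List A) :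
    applyM f (a :: v) = f a ++ applyM f v := by simp [applyM]

theorem applyM_nil {A B : Type*} (f : A → List B) : applyM f [] = [] := by simp [applyM]

theorem applyM_comp {A B C : Type*} (g : B → List C) (h : A → List B) (v : List A) :
    applyM g (applyM h v) = applyM (fun a => applyM g (h a)) v := by
  induction v with
  | nil => rfl
  | cons a v ih => simp only [applyM_cons, applyM_append, ih]

theorem applyM_prefix {A B : Type*} (f : A → List B) {u v : List A} (h : u <+: v) :
    applyM f u <+: applyM f v := by
  obtain ⟨t, rfl⟩ := h
  rw [applyM_append]; exact List.prefix_append _ _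

theorem applyM_infix {A B : Type*} (f : A → List B) {u v : List A} (h : u <:+: v) :
    applyM f u <:+: applyM f v := by
  obtain ⟨s, t, rfl⟩ := h
  rw [applyM_append, applyM_append]; exact List.infix_append _ _ _

theorem applyM_length {A B : Type*} (f : A → List B) (hf : Nonerasing f) (u : List A) :
    u.length ≤ (applyM f u).length := by
  induction u with
  | nil => simp
  | cons a u ih =>
    have := List.length_pos_of_ne_nil (hf a)
    simp only [applyM_cons, List.length_append, List.length_cons]; omega

theorem image_prefix {A B : Type*} {f : A → List B} {w : ℕ → A} {x : ℕ → B} {u : List A}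
    (hx : InfImage f w x) (h : IsPrefixI u w) : IsPrefixI (applyM f u) x := by
  rw [prefI_iff] at h
  rw [h]; exact hx _

theorem image_factor {A B : Type*} {f : A → List B} {w : ℕ → A} {x : ℕ → B} {u : List A}
    (hx : InfImage f w x) (h : IsFactorI u w) : IsFactorI (applyM f u) x := by
  rw [factI_iff] at h
  obtain ⟨n, hn⟩ := h
  exact factI_of_infix (applyM_infix f hn) (prefI_factI (hx n))

theorem prefix_image {A B : Type*} {f : A → List B} (hf : Nonerasing f) {w : ℕ → A} {x : ℕ → B}
    {u : List B} (hx : InfImage f w x) (h : IsPrefixI u x) :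
    u <+: applyM f (infPrefix w u.length) := by
  refine prefix_of_prefI h (hx _) ?_
  have := applyM_length f hf (infPrefix w u.length)
  rwa [infPrefix_length] at this

theorem factor_image {A B : Type*} {f : A → List B} (hf : Nonerasing f) {w : ℕ → A} {x : ℕ → B}
    {u : List B} (hx : InfImage f w x) (h : IsFactorI u x) :
    ∃ n, u <:+: applyM f (infPrefix w n) := by
  rw [factI_iff] at h
  obtain ⟨n, hn⟩ := h
  exact ⟨_, hn.trans (prefix_image hf hx (prefI_infPrefix x n)).isInfix⟩

theorem exists_image {A B : Type*} (f : A → List B) (hf : Nonerasing f) (w : ℕ → A) :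
    ∃ x, InfImage f w x := by
  have hlen : ∀ i, i < (applyM f (infPrefix w (i+1))).length := fun i => by
    have := applyM_length f hf (infPrefix w (i+1))
    rw [infPrefix_length] at this; omega
  refine ⟨fun i => (applyM f (infPrefix w (i+1)))[i]'(hlen i), ?_⟩
  intro n i hi
  simp only [List.get_eq_getElem]
  rcases le_total n (i+1) with h | h
  · exact (applyM_prefix f (infPrefix_mono w h)).getElem hi
  · exact ((applyM_prefix f (infPrefix_mono w h)).getElem (hlen i)).symm

theorem image_comp {A B C : Type*} {g : B → List C} {h : A → List B} {w : ℕ → A} {y : ℕ → B}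
    {x : ℕ → C} (hy : InfImage h w y) (hx : InfImage g y x) :
    InfImage (fun a => applyM g (h a)) w x := by
  intro n
  rw [← applyM_comp]
  exact image_prefix hx (hy n)

theorem image_decomp {A B C : Type*} {g : B → List C} {h : A → List B} (hh : Nonerasing h)
    {w : ℕ → A} {y : ℕ → B}
    {x : ℕ → C} (hy : InfImage h w y) (hx : InfImage (fun a => applyM g (h a)) w x) :
    InfImage g y x := by
  intro n
  have h1 := prefix_image hh hy (prefI_infPrefix y n)
  have h2 := hx (infPrefix y n).length
  rw [← applyM_comp] at h2
  exact prefI_of_prefix (applyM_prefix g h1) h2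

theorem lsp_iff {A : Type*} (w : ℕ → A) : IsLSP w ↔ ∀ i j n, w i ≠ w j →
    (∀ k < n, w (i+1+k) = w (j+1+k)) → ∀ k < n, w (i+1+k) = w k := by
  constructor
  · intro h i j n hij hn k hk
    have h1 := h (infPrefix (fun m => w (i+1+m)) n) ?_
    · have := h1 k (by rw [infPrefix_length]; exact hk)
      rw [List.get_eq_getElem, infPrefix_getElem] at this
      exact this
    · refine ⟨w i, w j, hij, ⟨i, ?_⟩, ⟨j, ?_⟩⟩
      · intro m hm
        cases m with
        | zero => simp
        | succ m =>
          simp only [List.get_eq_getElem, List.getElem_cons_succ]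
          rw [infPrefix_getElem]; congr 1; omega
      · intro m hm
        cases m with
        | zero => simp
        | succ m =>
          simp only [List.get_eq_getElem, List.getElem_cons_succ]
          rw [infPrefix_getElem, hn m (by simpa [infPrefix] using hm)]; congr 1; omega
  · rintro h u ⟨a, b, hab, ⟨i, hi⟩, ⟨j, hj⟩⟩
    have hi0 := hi 0 (by simp)
    have hj0 := hj 0 (by simp)
    have hi' : ∀ k (hk : k < u.length), u[k] = w (i+1+k) := fun k hk => by
      have := hi (k+1) (by simpa using hk)
      simp only [List.get_eq_getElem, List.getElem_cons_succ] at this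
      rw [this]; congr 1; omega
    have hj' : ∀ k (hk : k < u.length), u[k] = w (j+1+k) := fun k hk => by
      have := hj (k+1) (by simpa using hk)
      simp only [List.get_eq_getElem, List.getElem_cons_succ] at this
      rw [this]; congr 1; omega
    simp only [List.get_eq_getElem, List.getElem_cons_zero, Nat.add_zero] at hi0 hj0
    have := h i j u.length (by rwa [← hi0, ← hj0]) (fun k hk => by rw [← hi' k hk, ← hj' k hk])
    intro k hk
    rw [List.get_eq_getElem, hi' k hk, this k hk]

/-! periodic words -/

def per {A : Type*} (v : List A) (hv : v ≠ []) : ℕ → A :=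
  fun i => v[i % v.length]'(Nat.mod_lt _ (List.length_pos_of_ne_nil hv))

theorem per_lt {A : Type*} (v : List A) (hv : v ≠ []) (i : ℕ) (h : i < v.length) :
    per v hv i = v[i] := by
  simp [per, Nat.mod_eq_of_lt h]

theorem per_add {A : Type*} (v : List A) (hv : v ≠ []) (i : ℕ) :
    per v hv (i + v.length) = per v hv i := by
  simp [per]

theorem per_add_mul {A : Type*} (v : List A) (hv : v ≠ []) (i k : ℕ) :
    per v hv (i + k * v.length) = per v hv i := by
  simp [per]

theorem listPow_succ {A : Type*} (v : List A) (k : ℕ) : listPow v (k+1) = v ++ listPow v k := by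
  simp [listPow, List.replicate_succ]

theorem listPow_add {A : Type*} (v : List A) (k m : ℕ) :
    listPow v (k+m) = listPow v k ++ listPow v m := by
  induction k with
  | zero => simp [listPow]
  | succ k ih => rw [show k + 1 + m = (k + m) + 1 by omega, listPow_succ, listPow_succ, ih]; simp

theorem listPow_length {A : Type*} (v : List A) (k : ℕ) : (listPow v k).length = k * v.length := by
  simp [listPow]

theorem applyM_listPow {A B : Type*} (f : A → List B) (v : List A) (k : ℕ) :
    applyM f (listPow v k) = listPow (applyM f v) k := by
  induction k with
  | zero => simp [listPow, applyM]
  | succ k ih => rw [listPow_succ, listPow_succ, applyM_append, ih]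

theorem infPrefix_per {A : Type*} (v : List A) (hv : v ≠ []) (k : ℕ) :
    infPrefix (per v hv) (k * v.length) = listPow v k := by
  induction k with
  | zero => simp [infPrefix, listPow]
  | succ k ih =>
    rw [Nat.succ_mul, Nat.add_comm, infPrefix_add, listPow_succ, ← ih]
    congr 1
    · apply List.ext_getElem
      · simp [infPrefix]
      · intro i h1 h2
        rw [infPrefix_getElem, per_lt]
    · congr 1
      funext i
      rw [Nat.add_comm, per_add]

theorem image_per {A B : Type*} (f : A → List B) (v : List A) (hv : v ≠ [])
    (hv' : applyM f v ≠ []) : InfImage f (per v hv) (per (applyM f v) hv') := by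
  intro n
  have h1 : n ≤ n * v.length := Nat.le_mul_of_pos_right _ (List.length_pos_of_ne_nil hv)
  refine prefI_of_prefix (applyM_prefix f (infPrefix_mono _ h1)) ?_
  rw [infPrefix_per, applyM_listPow, ← infPrefix_per _ hv']
  exact prefI_infPrefix _ _

theorem image_per' {A B : Type*} (f : A → List B) (v : List A) (hv : v ≠ [])
    (z : List B) (hz : z ≠ []) (he : applyM f v = z) : InfImage f (per v hv) (per z hz) := by
  subst he; exact image_per f v hv hz

theorem per_nodup_lsp {A : Type*} (v : List A) (hv : v ≠ []) (hd : v.Nodup) :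
    IsLSP (per v hv) := by
  rw [lsp_iff]
  intro i j n hij hn
  rcases Nat.eq_zero_or_pos n with h0 | h0
  · subst h0; intro k hk; omega
  · exfalso
    have h1 := hn 0 h0
    simp only [per, Nat.add_zero] at h1
    rw [hd.getElem_inj_iff] at h1
    have h2 : i % v.length = j % v.length := Nat.ModEq.add_right_cancel' 1 h1
    exact hij (by simp [per, h2])

theorem per_rot {A : Type*} (s t : List A) (h1 : s ++ t ≠ []) (h2 : t ++ s ≠ []) (i : ℕ) :
    per (s ++ t) h1 (s.length + i) = per (t ++ s) h2 i := by
  have hl : (s ++ t).length = (t ++ s).length := by simp [Nat.add_comm]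
  have hp : 0 < (t ++ s).length := List.length_pos_of_ne_nil h2
  have key : ∀ m, m < (t ++ s).length → per (s ++ t) h1 (s.length + m) = per (t ++ s) h2 m := by
    intro m hm
    rw [per_lt _ h2 m hm]
    by_cases hmt : m < t.length
    · rw [per_lt _ _ _ (by simp; omega)]
      simp [List.getElem_append, hmt]
    · have hm' : m < t.length + s.length := by simpa using hm
      have : s.length + m = (m - t.length) + (s ++ t).length := by simp; omega
      rw [this, per_add, per_lt _ _ _ (by simp; omega)]
      have h3 : m - t.length < s.length := by omega
      simp [List.getElem_append, hmt, h3]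
  have hi := Nat.mod_add_div' i (t ++ s).length
  rw [← hi, per_add_mul, ← key _ (Nat.mod_lt _ hp), ← Nat.add_assoc, ← hl, per_add_mul]

/-! the morphisms `L` -/

section Lpart
variable {A : Type*} [DecidableEq A]

def decL (α : A) : List A → List A
  | [] => []
  | [_] => []
  | _ :: b :: t => if b = α then α :: decL α (b :: t) else b :: decL α t

theorem Lmor_ne (α : A) : Nonerasing (Lmor α) := by
  intro a; unfold Lmor; split <;> simp

theorem Lmor_head (α b : A) : ∃ t, Lmor α b = α :: t := by
  unfold Lmor; split <;> simp

theorem applyM_L_head (α : A) (s : List A) (c : A) (t : List A) (h : c :: t <+: applyM (Lmor α) s) :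
    c = α := by
  cases s with
  | nil => simp [applyM_nil] at h
  | cons d s =>
    obtain ⟨r, hr⟩ := Lmor_head α d
    rw [applyM_cons, hr] at h
    simp at h; exact h.1

theorem decL_prefix (α : A) : ∀ (s u : List A), α :: u <+: applyM (Lmor α) s →
    decL α (α :: u) <+: s ∧ α :: u <+: applyM (Lmor α) (decL α (α :: u)) ++ [α] := by
  intro s
  induction s with
  | nil => intro u h; simp [applyM_nil] at h
  | cons d s ih =>
    intro u h
    rw [applyM_cons] at h
    cases u with
    | nil => simp [decL, applyM_nil]
    | cons b t =>
      by_cases hd : d = α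
      · subst hd
        simp only [Lmor, if_true, List.cons_append, List.nil_append,
          List.cons_prefix_cons, true_and] at h
        have hb := applyM_L_head _ _ _ _ h
        subst hb
        obtain ⟨h1, h2⟩ := ih t h
        simp only [decL, if_true]
        refine ⟨by simpa using h1, ?_⟩
        rw [applyM_cons]
        simpa [Lmor] using h2
      · simp only [Lmor, if_neg hd, List.cons_append, List.nil_append,
          List.cons_prefix_cons, true_and] at h
        obtain ⟨hb, h⟩ := h
        subst hb
        simp only [decL, if_neg hd]
        rw [applyM_cons]
        cases t with
        | nil => simp [decL, Lmor, hd]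
        | cons c t =>
          have hc := applyM_L_head _ _ _ _ h
          subst hc
          obtain ⟨h1, h2⟩ := ih t h
          refine ⟨by simpa using h1, ?_⟩
          simpa [Lmor, hd] using h2

theorem L_factor_head (α : A) (s u : List A) (c b : A) (h : c :: b :: u <:+: applyM (Lmor α) s) :
    c = α ∨ b = α := by
  induction s with
  | nil => simp [applyM_nil] at h
  | cons d s ih =>
    rw [applyM_cons] at h
    by_cases hd : d = α
    · simp only [Lmor, if_pos hd, List.cons_append, List.nil_append, List.infix_cons_iff,
        List.cons_prefix_cons] at h
      rcases h with h | h
      · exact Or.inl h.1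
      · exact ih h
    · simp only [Lmor, if_neg hd, List.cons_append, List.nil_append, List.infix_cons_iff,
        List.cons_prefix_cons] at h
      rcases h with h | h | h
      · exact Or.inl h.1
      · exact Or.inr (applyM_L_head _ _ _ _ h.2)
      · exact ih h

theorem L_factor_dec (α : A) (s u : List A) (c : A) (h : c :: α :: u <:+: applyM (Lmor α) s) :
    c :: decL α (α :: u) <:+: s ∧ α :: u <+: applyM (Lmor α) (decL α (α :: u)) ++ [α] := by
  induction s with
  | nil => simp [applyM_nil] at h
  | cons d s ih =>
    rw [applyM_cons] at h
    by_cases hd : d = α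
    · simp only [Lmor, if_pos hd, List.cons_append, List.nil_append] at h
      rw [List.infix_cons_iff, List.cons_prefix_cons] at h
      rcases h with ⟨rfl, h⟩ | h
      · obtain ⟨h1, h2⟩ := decL_prefix _ _ _ h
        refine ⟨?_, h2⟩
        subst hd
        exact (List.cons_prefix_cons.2 ⟨rfl, h1⟩).isInfix
      · exact ⟨(ih h).1.trans (List.suffix_cons d s).isInfix, (ih h).2⟩
    · simp only [Lmor, if_neg hd, List.cons_append, List.nil_append] at h
      rw [List.infix_cons_iff, List.cons_prefix_cons, List.infix_cons_iff] at h
      rcases h with ⟨rfl, h⟩ | h | h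
      · rw [List.cons_prefix_cons] at h
        exact absurd h.1.symm hd
      · rw [List.cons_prefix_cons] at h
        obtain ⟨rfl, h⟩ := h
        obtain ⟨h1, h2⟩ := decL_prefix _ _ _ h
        exact ⟨(List.cons_prefix_cons.2 ⟨rfl, h1⟩).isInfix, h2⟩
      · exact ⟨(ih h).1.trans (List.suffix_cons d s).isInfix, (ih h).2⟩

theorem L_preserves (α : A) : PreservesLSP (Lmor α) := by
  rintro w x hw hx u ⟨a, b, hab, ha, hb⟩
  cases u with
  | nil => intro i hi; simp at hi
  | cons c u =>
    obtain ⟨n, hn⟩ := factor_image (Lmor_ne α) hx ha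
    obtain ⟨m, hm⟩ := factor_image (Lmor_ne α) hx hb
    have hc : c = α := by
      rcases L_factor_head α _ _ _ _ hn with h1 | h1
      · rcases L_factor_head α _ _ _ _ hm with h2 | h2
        · exact absurd (h1.trans h2.symm) hab
        · exact h2
      · exact h1
    subst hc
    obtain ⟨h1, h2⟩ := L_factor_dec c _ _ _ hn
    obtain ⟨h3, -⟩ := L_factor_dec c _ _ _ hm
    have := hw (decL c (c :: u)) ⟨a, b, hab, (factI_iff _ _).2 ⟨n, h1⟩, (factI_iff _ _).2 ⟨m, h3⟩⟩
    obtain ⟨e, he⟩ := prefI_extend this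
    have h4 := image_prefix hx he
    refine prefI_of_prefix ?_ h4
    refine h2.trans ?_
    obtain ⟨r, hr⟩ := Lmor_head c e
    rw [applyM_append, applyM_cons, hr]
    simp

theorem perm_preserves (σ : A → A) (hσ : Function.Injective σ) :
    PreservesLSP (fun a => [σ a]) := by
  intro w x hw hx
  have : ∀ i, x i = σ (w i) := by
    intro i
    have := hx (i+1)
    have h3 : applyM (fun a => [σ a]) (infPrefix w (i+1)) = (infPrefix w (i+1)).map σ := by
      generalize infPrefix w (i+1) = l
      induction l with
      | nil => rfl
      | cons a l ih => rw [applyM_cons, ih]; rfl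
    have h2 := this i (by rw [h3]; simp [infPrefix])
    rw [← h2]
    simp only [h3, List.get_eq_getElem, List.getElem_map, infPrefix_getElem]
  rw [lsp_iff] at *
  intro i j n hij hn k hk
  simp only [this] at *
  rw [hw i j n (fun h => hij (by rw [h])) (fun k hk => hσ (hn k hk)) k hk]

theorem chain_ne (l : List A) (σ : A → A) :
    Nonerasing (fun a => l.foldr (fun α v => applyM (Lmor α) v) [σ a]) := by
  induction l with
  | nil => intro a; simp
  | cons α l ih =>
    intro a
    simp only [List.foldr_cons]
    intro h
    have h1 := applyM_length _ (Lmor_ne α) (l.foldr (fun α v => applyM (Lmor α) v) [σ a])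
    rw [h] at h1
    simp at h1
    exact ih a h1

theorem chain_preserves (l : List A) (σ : A → A) (hσ : Function.Injective σ) :
    PreservesLSP (fun a => l.foldr (fun α v => applyM (Lmor α) v) [σ a]) := by
  induction l with
  | nil => exact perm_preserves σ hσ
  | cons α l ih =>
    intro w x hw hx
    obtain ⟨y, hy⟩ := exists_image _ (chain_ne l σ) w
    exact L_preserves α y x (ih w y hw hy)
      (image_decomp (g := Lmor α) (chain_ne l σ) hy hx)

theorem plsp_preserves (f : A → List A) (hf : InPLSP f) : PreservesLSP f := by
  obtain ⟨hne, u, hu, hp, hL⟩ := hf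
  intro w x hw hx
  apply hL
  intro k
  have : ∀ s : List A, ∃ m, s.length ≤ m ∧ applyM f s = listPow u m := by
    intro s
    induction s with
    | nil => exact ⟨0, by simp, by simp [applyM, listPow]⟩
    | cons a s ih =>
      obtain ⟨m, hm, he⟩ := ih
      obtain ⟨k, hk, hf⟩ := hp a
      exact ⟨k + m, by simp; omega, by rw [applyM_cons, he, hf, listPow_add]⟩
  obtain ⟨m, hm, he⟩ := this (infPrefix w k)
  have h1 := hx k
  rw [he] at h1
  rw [infPrefix_length] at hm
  refine prefI_of_prefix ?_ h1
  obtain ⟨d, rfl⟩ := Nat.exists_eq_add_of_le hm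
  rw [listPow_add]
  exact List.prefix_append _ _

theorem L_frag_aux (δ p a : A) (u : List A) (w x : ℕ → A) (hx : InfImage (Lmor δ) w x)
    (h : IsFactorI (p :: (u ++ [a])) w) :
    IsFactorI (p :: ((applyM (Lmor δ) u ++ [δ]) ++ [a])) x := by
  obtain ⟨e, he⟩ := factI_extend h
  have h1 := image_factor hx he
  refine factI_of_infix ?_ h1
  obtain ⟨r, hr⟩ := Lmor_head δ e
  have h2 : ∃ q, Lmor δ p = q ++ [p] := by
    unfold Lmor; split
    · next h => exact ⟨[], by simp [h]⟩
    · exact ⟨[δ], by simp⟩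
  obtain ⟨q, hq⟩ := h2
  have h3 : ∃ r', Lmor δ a ++ δ :: r = δ :: a :: r' := by
    unfold Lmor; split
    · next h => exact ⟨r, by simp [h]⟩
    · exact ⟨δ :: r, by simp⟩
  obtain ⟨r', hr'⟩ := h3
  have : applyM (Lmor δ) (p :: (u ++ [a]) ++ [e]) =
    q ++ (p :: ((applyM (Lmor δ) u ++ [δ]) ++ [a])) ++ r' := by
    simp only [List.cons_append, applyM_cons, applyM_append, hq, hr, applyM_nil]
    simp [hr']
  rw [this]
  exact List.infix_append _ _ _

theorem L_frag (δ a b c : A) (w x : ℕ → A) (hx : InfImage (Lmor δ) w x)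
    (h : Fragile w a b c) : Fragile x a b c := by
  obtain ⟨u, β, γ, hbg, h1, h2, h3⟩ := h
  refine ⟨applyM (Lmor δ) u ++ [δ], β, γ, hbg, ?_, L_frag_aux δ β b u w x hx h2,
    L_frag_aux δ γ c u w x hx h3⟩
  obtain ⟨e, he⟩ := prefI_extend h1
  have h1 := image_prefix hx he
  refine prefI_of_prefix ?_ h1
  obtain ⟨r, hr⟩ := Lmor_head δ e
  have h3 : ∃ r', Lmor δ a ++ δ :: r = δ :: a :: r' := by
    unfold Lmor; split
    · next h => exact ⟨r, by simp [h]⟩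
    · exact ⟨δ :: r, by simp⟩
  obtain ⟨r', hr'⟩ := h3
  have : applyM (Lmor δ) ((u ++ [a]) ++ [e]) =
    ((applyM (Lmor δ) u ++ [δ]) ++ [a]) ++ r' := by
    simp only [applyM_cons, applyM_append, hr, applyM_nil]
    simp [hr']
  rw [this]
  exact List.prefix_append _ _

/-- For every chain there is an LSP word whose image is fragile. -/
theorem chain_frag (l : List A) (σ : Equiv.Perm A) (a b c : A) (hab : a ≠ b) (hac : a ≠ c)
    (hbc : b ≠ c) :
    ∃ w y, IsLSP w ∧ InfImage (fun a => l.foldr (fun α v => applyM (Lmor α) v) [σ a]) w y ∧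
      Fragile y a b c := by
  induction l with
  | nil =>
    have hv : [σ.symm a, σ.symm b, σ.symm c] ≠ [] := by simp
    refine ⟨per [σ.symm a, σ.symm b, σ.symm c] hv, per [a,b,c] (by simp),
      per_nodup_lsp _ _ (by simp [hab, hac, hbc]), ?_, ?_⟩
    · exact image_per' (fun a => [σ a]) _ hv _ (by simp) (by simp [applyM])
    · refine ⟨[], a, b, hab, ?_, ⟨0, ?_⟩, ⟨1, ?_⟩⟩
      · intro i hi
        simp at hi; subst hi; rfl
      · intro i hi
        simp at hi
        interval_cases i <;> rfl
      · intro i hi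
        simp at hi
        interval_cases i <;> rfl
  | cons δ l ih =>
    obtain ⟨w, y, hw, hy, hf⟩ := ih
    obtain ⟨x, hx⟩ := exists_image _ (Lmor_ne δ) y
    exact ⟨w, x, hw, image_comp hy hx, L_frag δ a b c y x hx hf⟩

end Lpart

/-! distinct first letters -/

section Heads
variable {A : Type*} [DecidableEq A]

theorem uniq_pred (s t : List A) (hs : s ≠ []) (ht : t ≠ []) (h1 : s ++ t ≠ []) (h2 : t ++ s ≠ [])
    (hst : s.head hs ≠ t.head ht) (hL1 : IsLSP (per (s ++ t) h1)) (hL2 : IsLSP (per (t ++ s) h2)) :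
    ∀ i j, per (s ++ t) h1 (i+1) = per (s ++ t) h1 (j+1) → per (s ++ t) h1 i = per (s ++ t) h1 j := by
  intro i j hij
  by_contra hne
  rw [lsp_iff] at hL1 hL2
  have a1 := hL1 i j 1 hne (fun k hk => by
    have : k = 0 := by omega
    subst this; exact hij) 0 (by omega)
  have e : ∀ n, per (t ++ s) h2 (t.length + n) = per (s ++ t) h1 n := fun n => per_rot t s h2 h1 n
  have a2 := hL2 (t.length + i) (t.length + j) 1 (by rw [e, e]; exact hne) (fun k hk => by
    have : k = 0 := by omega
    subst this
    rw [show t.length + i + 1 + 0 = t.length + (i + 1) by omega,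
      show t.length + j + 1 + 0 = t.length + (j + 1) by omega, e, e]; exact hij) 0 (by omega)
  rw [Nat.add_zero, Nat.add_assoc, e] at a2
  rw [Nat.add_zero, a2] at a1
  have ls := List.length_pos_of_ne_nil hs
  have lt := List.length_pos_of_ne_nil ht
  rw [per_lt _ _ _ (by simp; omega), per_lt _ _ _ (by simp; omega)] at a1
  rw [List.getElem_append_left ls, List.getElem_append_left lt] at a1
  apply hst
  rw [List.head_eq_getElem, List.head_eq_getElem, a1]

theorem per_uniq_forward (z : List A) (hz : z ≠ [])
    (hu : ∀ i j, per z hz (i+1) = per z hz (j+1) → per z hz i = per z hz j) (i j : ℕ)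
    (hij : per z hz i = per z hz j) (n : ℕ) : per z hz (i + n) = per z hz (j + n) := by
  have back : ∀ m i j, per z hz (i+m) = per z hz (j+m) → per z hz i = per z hz j := by
    intro m
    induction m with
    | zero => intro i j h; exact h
    | succ m ih => intro i j h; exact ih i j (hu _ _ h)
  have hl : n ≤ n * z.length := Nat.le_mul_of_pos_right _ (List.length_pos_of_ne_nil hz)
  apply back (n * z.length - n)
  rw [show i + n + (n * z.length - n) = i + n * z.length by omega,
    show j + n + (n * z.length - n) = j + n * z.length by omega, per_add_mul, per_add_mul, hij]

theorem lsp_image_per (f : A → List A) (hP : PreservesLSP f) (v : List A) (hv : v ≠ [])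
    (hL : IsLSP (per v hv)) (z : List A) (hz : z ≠ []) (he : applyM f v = z) :
    IsLSP (per z hz) := by
  subst he
  exact hP _ _ hL (image_per f v hv hz)

theorem aab_lsp (a b : A) (hab : a ≠ b) : IsLSP (per [a, a, b] (by simp)) :=
  lsp_image_per (Lmor a) (L_preserves a) [a, b] (by simp) (per_nodup_lsp _ _ (by simp [hab])) _ _
    (by simp [applyM, Lmor, hab.symm])

theorem heads_nodup (f : A → List A) (hne : Nonerasing f) (hP : PreservesLSP f) (a b : A)
    (hab : (f a).head (hne a) ≠ (f b).head (hne b)) : (f a ++ f b).Nodup := by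
  have hab' : a ≠ b := by rintro rfl; exact hab rfl
  have z0 : f a ++ f b ≠ [] := by simp [hne a]
  have z1 : f b ++ f a ≠ [] := by simp [hne b]
  have z2 : f a ++ (f a ++ f b) ≠ [] := by simp [hne a]
  have z3 : (f a ++ f b) ++ f a ≠ [] := by simp [hne a]
  have L0 : IsLSP (per (f a ++ f b) z0) :=
    lsp_image_per f hP [a, b] (by simp) (per_nodup_lsp _ _ (by simp [hab'])) _ _ (by simp [applyM])
  have L1 : IsLSP (per (f b ++ f a) z1) :=
    lsp_image_per f hP [b, a] (by simp) (per_nodup_lsp _ _ (by simp [hab'.symm])) _ _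
      (by simp [applyM])
  have L2 : IsLSP (per (f a ++ (f a ++ f b)) z2) :=
    lsp_image_per f hP [a, a, b] (by simp) (aab_lsp a b hab') _ _ (by simp [applyM])
  have hu := uniq_pred _ _ (hne a) (hne b) z0 z1 hab L0 L1
  have hfw := per_uniq_forward _ z0 hu
  have la := List.length_pos_of_ne_nil (hne a)
  have lb := List.length_pos_of_ne_nil (hne b)
  have X0 : per (f a ++ f b) z0 0 = (f a).head (hne a) := by
    rw [per_lt _ _ _ (by simp; omega), List.getElem_append_left la, List.head_eq_getElem]
  have Xa : per (f a ++ f b) z0 (f a).length = (f b).head (hne b) := by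
    rw [per_lt _ _ _ (by simp; omega), List.getElem_append_right le_rfl, List.head_eq_getElem]
    simp
  have hlen : (f a ++ f b).length = (f a).length + (f b).length := by simp
  have hY : ∀ n, n < (f a ++ f b).length + (f a).length →
      per (f a ++ (f a ++ f b)) z2 ((f a).length + n) = per (f a ++ f b) z0 n := by
    intro n hn
    rw [per_rot _ _ z2 z3, per_lt _ z3 _ (by simp at *; omega)]
    by_cases h : n < (f a ++ f b).length
    · rw [List.getElem_append_left h, per_lt _ _ _ h]
    · rw [List.getElem_append_right (by omega)]
      obtain ⟨m, rfl⟩ := Nat.exists_eq_add_of_le (not_lt.1 h)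
      have e2 : per (f a ++ f b) z0 ((f a ++ f b).length + m) = (f a)[m]'(by omega) := by
        rw [Nat.add_comm, per_add, per_lt _ _ _ (by omega), List.getElem_append_left (by omega)]
      rw [e2]
      congr 1
      omega
  have hY0 : per (f a ++ (f a ++ f b)) z2 ((f a).length - 1) =
      per (f a ++ f b) z0 ((f a).length - 1) := by
    rw [per_lt _ _ _ (by simp; omega), per_lt _ _ _ (by simp; omega),
      List.getElem_append_left (by omega), List.getElem_append_left (by omega)]
  set X := per (f a ++ f b) z0 with hX
  set Y := per (f a ++ (f a ++ f b)) z2 with hYd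
  by_contra hnd
  obtain ⟨i, j, hij, hjl, heq⟩ : ∃ i j, i < j ∧ j < (f a ++ f b).length ∧ X i = X j := by
    rw [List.nodup_iff_injective_get] at hnd
    simp only [Function.Injective, not_forall] at hnd
    obtain ⟨⟨i, hi⟩, ⟨j, hj⟩, h1, h2⟩ := hnd
    simp only [List.get_eq_getElem] at h1
    have h3 : X i = X j := by rw [hX, per_lt _ _ _ hi, per_lt _ _ _ hj, h1]
    have h4 : i ≠ j := fun h => h2 (by simp [h])
    rcases lt_or_gt_of_ne h4 with h | h
    · exact ⟨i, j, h, hj, h3⟩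
    · exact ⟨j, i, h, hi, h3.symm⟩
  obtain ⟨d, rfl⟩ := Nat.exists_eq_add_of_lt hij
  -- the period is `d + 1`
  have hper : ∀ n, X (n + (d + 1)) = X n := by
    intro n
    have h1 := hfw i (i + d + 1) heq ((f a ++ f b).length - i + n)
    rw [show i + ((f a ++ f b).length - i + n) = n + (f a ++ f b).length by omega,
      show i + d + 1 + ((f a ++ f b).length - i + n) = (n + (d+1)) + (f a ++ f b).length by omega] at h1
    rw [hX, per_add, per_add] at h1
    exact h1.symm
  have hd : X d = X ((f a ++ f b).length - 1) := by
    have h1 := hper ((f a ++ f b).length - 1)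
    rw [show (f a ++ f b).length - 1 + (d + 1) = d + (f a ++ f b).length by omega, hX, per_add] at h1
    exact h1
  have hee : X ((f a).length - 1) ≠ X d := by
    intro h
    rw [hd] at h
    have h1 := hfw _ _ h 1
    rw [show (f a).length - 1 + 1 = (f a).length by omega,
      show (f a ++ f b).length - 1 + 1 = 0 + (f a ++ f b).length by omega] at h1
    have h2 : X (0 + (f a ++ f b).length) = X 0 := per_add _ _ _
    rw [h2, Xa, X0] at h1
    exact hab h1.symm
  rw [lsp_iff] at L2
  have := L2 ((f a).length - 1) ((f a).length + d) ((f a).length + 1)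
    (by rw [hY0, hY d (by omega)]; exact hee)
    (fun k hk => by
      rw [show (f a).length - 1 + 1 + k = (f a).length + k by omega,
        show (f a).length + d + 1 + k = (f a).length + (k + (d + 1)) by omega,
        hY _ (by omega), hY _ (by omega), hper])
    (f a).length (by omega)
  rw [show (f a).length - 1 + 1 + (f a).length = (f a).length + (f a).length by omega,
    hY _ (by omega), Xa] at this
  have h2 := hY 0 (by omega)
  rw [Nat.add_zero, X0] at h2
  exact hab (by rw [this, ← h2])

theorem heads_perm [Fintype A] (f : A → List A) (hne : Nonerasing f) (hP : PreservesLSP f)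
    (hh : ∃ a b, (f a).head (hne a) ≠ (f b).head (hne b)) :
    ∃ σ : Equiv.Perm A, ∀ a, f a = [σ a] := by
  have hinj : Function.Injective (fun a => (f a).head (hne a)) := by
    intro a c hac
    by_contra hne'
    simp only at hac
    obtain ⟨b, hb⟩ : ∃ b, (f a).head (hne a) ≠ (f b).head (hne b) := by
      obtain ⟨p, q, hpq⟩ := hh
      by_cases h : (f a).head (hne a) = (f p).head (hne p)
      · exact ⟨q, by rw [h]; exact hpq⟩
      · exact ⟨p, h⟩
    have hab : a ≠ b := by rintro rfl; exact hb rfl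
    have hcb : c ≠ b := by rintro rfl; exact hb hac
    have N1 := heads_nodup f hne hP a b hb
    have z0 : f a ++ (f c ++ f b) ≠ [] := by simp [hne a]
    have z1 : (f a ++ f c) ++ f b ≠ [] := by simp [hne a]
    have z2 : f b ++ (f a ++ f c) ≠ [] := by simp [hne b]
    have n1 : f a ++ f c ≠ [] := by simp [hne a]
    have L1 : IsLSP (per ((f a ++ f c) ++ f b) z1) :=
      lsp_image_per f hP [a, c, b] (by simp) (per_nodup_lsp _ _ (by simp [hab, hcb, hne'])) _ _
        (by simp [applyM])
    have L2 : IsLSP (per (f b ++ (f a ++ f c)) z2) :=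
      lsp_image_per f hP [b, a, c] (by simp)
        (per_nodup_lsp _ _ (by simp [hab.symm, hcb.symm, hne'])) _ _ (by simp [applyM])
    have hu := uniq_pred _ _ n1 (hne b) z1 z2 (by rw [List.head_append_of_ne_nil (hne a)]; exact hb) L1 L2
    have la := List.length_pos_of_ne_nil (hne a)
    have lb := List.length_pos_of_ne_nil (hne b)
    have lc := List.length_pos_of_ne_nil (hne c)
    have hl : ((f a ++ f c) ++ f b).length = (f a).length + (f c).length + (f b).length := by
      simp [Nat.add_assoc]
    have h1 := hu ((f a).length - 1) (((f a ++ f c) ++ f b).length - 1) (by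
      rw [show (f a).length - 1 + 1 = (f a).length by omega,
        show ((f a ++ f c) ++ f b).length - 1 + 1 = 0 + ((f a ++ f c) ++ f b).length by omega,
        per_add, per_lt _ _ _ (by omega), per_lt _ _ _ (by omega)]
      rw [List.head_eq_getElem, List.head_eq_getElem] at hac
      have q1 : ((f a ++ f c) ++ f b)[(f a).length]'(by omega) = (f c)[0] := by
        rw [List.getElem_append_left (by simp; omega), List.getElem_append_right le_rfl]
        simp
      have q2 : ((f a ++ f c) ++ f b)[0]'(by omega) = (f a)[0] := by
        rw [List.getElem_append_left (by simp; omega), List.getElem_append_left la]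
      rw [q1, q2, hac])
    rw [per_lt _ _ _ (by omega), per_lt _ _ _ (by omega),
      List.getElem_append_left (by simp; omega), List.getElem_append_left (by omega),
      List.getElem_append_right (by simp; omega)] at h1
    have h2 := (List.nodup_append.1 N1).2.2 _ (List.getElem_mem (l := f a) (n := (f a).length - 1) (by omega))
      _ (List.getElem_mem (l := f b) (n := (f a ++ f c ++ f b).length - 1 - (f a ++ f c).length) (by simp; omega))
    exact h2 h1
  have hbij := Finite.injective_iff_bijective.1 hinj
  refine ⟨Equiv.ofBijective _ hbij, ?_⟩
  intro a
  simp only [Equiv.ofBijective_apply]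
  obtain ⟨b, hb⟩ : ∃ b, (f a).head (hne a) ≠ (f b).head (hne b) := by
    obtain ⟨p, q, hpq⟩ := hh
    by_cases h : (f a).head (hne a) = (f p).head (hne p)
    · exact ⟨q, by rw [h]; exact hpq⟩
    · exact ⟨p, h⟩
  have N1 := (List.nodup_append.1 (heads_nodup f hne hP a b hb)).1
  have aux : ∀ (l : List A) (h : l ≠ []), (∀ y y' t, l ≠ y :: y' :: t) → l = [l.head h] := by
    intro l h hl
    match l, h, hl with
    | [y], _, _ => rfl
    | y :: y' :: t, _, hl => exact absurd rfl (hl y y' t)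
  apply aux
  intro y y' t hfa
  obtain ⟨c, hc⟩ := hbij.2 y'
  simp only at hc
  have hca : c ≠ a := by
    rintro rfl
    rw [hfa] at N1
    simp only [hfa, List.head_cons] at hc
    simp [hc] at N1
  have N2 := heads_nodup f hne hP a c (fun h => hca (hinj h.symm))
  exact (List.nodup_append.1 N2).2.2 y' (by simp [hfa]) y' (by rw [← hc]; exact List.head_mem _) rfl

end Heads

/-! common first letter -/

section Common
variable {A : Type*} [DecidableEq A]

/-- block condition -/
def BlockS (α : A) (p : A → A) (t : List A) : Prop :=
  (∃ r, t = α :: r ∧ α ∉ r) ∧ t.IsChain (fun y z => z ≠ α → y = p z)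

theorem block_decomp (α : A) (p : A → A) : ∀ (n : ℕ) (v : List A), v.length ≤ n →
    (v = [] ∨ ∃ r, v = α :: r) →
    v.IsChain (fun y z => z ≠ α → y = p z) →
    ∃ L : List (List A), v = L.flatten ∧ ∀ t ∈ L, BlockS α p t := by
  intro n
  induction n with
  | zero =>
    intro v hv _ _
    have : v = [] := List.eq_nil_of_length_eq_zero (by omega)
    exact ⟨[], by simp [this], by simp⟩
  | succ n ih =>
    intro v hv hh hc
    rcases hh with rfl | ⟨r, rfl⟩
    · exact ⟨[], by simp, by simp⟩
    · have hs : r.takeWhile (fun z => decide (z ≠ α)) ++ r.dropWhile (fun z => decide (z ≠ α)) = r :=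
        List.takeWhile_append_dropWhile
      set s := r.takeWhile (fun z => decide (z ≠ α)) with hsd
      set d := r.dropWhile (fun z => decide (z ≠ α)) with hdd
      have hsα : α ∉ s := by
        intro h
        have := List.mem_takeWhile_imp h
        simp at this
      have hd : d = [] ∨ ∃ r, d = α :: r := by
        rcases hd' : d with _ | ⟨y, d'⟩
        · exact Or.inl rfl
        · right
          have h1 := List.head_dropWhile_not (fun z => decide (z ≠ α)) (l := r)
            (by rw [← hdd, hd']; simp)
          simp only [← hdd, hd', List.head_cons] at h1
          simp at h1
          exact ⟨d', by rw [h1]⟩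
      have he : α :: r = (α :: s) ++ d := by simp [hs]
      rw [he] at hc
      obtain ⟨L, hL1, hL2⟩ := ih d (by
        have := congrArg List.length hs
        simp at this hv; omega) hd (hc.right_of_append)
      refine ⟨(α :: s) :: L, by rw [he, hL1]; simp, ?_⟩
      intro t ht
      rcases List.mem_cons.1 ht with rfl | ht
      · exact ⟨⟨s, rfl, hsα⟩, hc.left_of_append⟩
      · exact hL2 t ht

theorem block_uniq (α : A) (p : A → A) : ∀ (t t' : List A) (b : A), BlockS α p (t ++ [b]) →
    BlockS α p (t' ++ [b]) → t = t' := by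
  intro t
  induction t using List.reverseRecOn with
  | nil =>
    intro t' b h h'
    obtain ⟨⟨r, hr, hα⟩, -⟩ := h
    obtain ⟨⟨r', hr', hα'⟩, -⟩ := h'
    simp at hr
    rcases t' with _ | ⟨y, t'⟩
    · rfl
    · exfalso
      simp at hr'
      apply hα'
      rw [← hr'.2, hr.1]
      simp
  | append_singleton t c ih =>
    intro t' b h h'
    induction t' using List.reverseRecOn with
    | nil =>
      exfalso
      obtain ⟨⟨r, hr, hα⟩, -⟩ := h
      obtain ⟨⟨r', hr', hα'⟩, -⟩ := h'
      simp at hr'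
      rcases t with _ | ⟨y, t⟩
      · simp at hr
        apply hα
        rw [← hr.2, hr'.1]; simp
      · simp at hr
        apply hα
        rw [← hr.2, hr'.1]; simp
    | append_singleton t' c' _ =>
      have key : ∀ (s : List A) (e : A), BlockS α p (s ++ [e] ++ [b]) →
          BlockS α p (s ++ [e]) ∧ e = p b := by
        intro s e hs
        obtain ⟨⟨r, hr, hα⟩, hc⟩ := hs
        have hb : b ≠ α := by
          rintro rfl
          rcases s with _ | ⟨y, s⟩
          · simp at hr; apply hα; rw [← hr.2]; simp
          · simp at hr; apply hα; rw [← hr.2]; simp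
        refine ⟨⟨?_, hc.left_of_append⟩, ?_⟩
        · rcases s with _ | ⟨y, s⟩
          · simp at hr
            exact ⟨[], by simp [hr.1], by simp⟩
          · simp at hr
            refine ⟨s ++ [e], by simp [hr.1], ?_⟩
            intro h
            apply hα
            rw [← hr.2]
            simp at h ⊢
            tauto
        · rw [List.append_assoc] at hc
          have := hc.right_of_append
          simp at this
          exact this hb
      obtain ⟨h1, h2⟩ := key t c h
      obtain ⟨h3, h4⟩ := key t' c' h'
      rw [← h2] at h4
      subst h4
      rw [ih t' _ h1 h3]

/-- good substitutions: `α r` with `α ∉ r` and last letter the letter itself. -/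
def GoodG (α : A) (g : A → List A) : Prop :=
  (∀ b, ∃ r, g b = α :: r ∧ α ∉ r) ∧ ∀ b, ∃ s, g b = s ++ [b]

theorem good_ne (α : A) (g : A → List A) (hg : GoodG α g) : Nonerasing g := by
  intro b
  obtain ⟨r, hr, -⟩ := hg.1 b
  simp [hr]

theorem good_decode (α : A) (g : A → List A) (hg : GoodG α g) : ∀ v s : List A,
    applyM g v ++ [α] <+: applyM g s → v <+: s := by
  have aux : ∀ r r' m m' : List A, α ∉ r → α ∉ r' → r ++ α :: m <+: r' ++ m' →
      (m' = [] ∨ ∃ q, m' = α :: q) → r = r' := by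
    intro r
    induction r with
    | nil =>
      intro r' m m' _ h2 h3 _
      rcases r' with _ | ⟨y, r'⟩
      · rfl
      · simp at h2 h3; exact absurd h3.1 h2.1
    | cons y r ih =>
      intro r' m m' h1 h2 h3 h4
      rcases r' with _ | ⟨y', r'⟩
      · rcases h4 with rfl | ⟨q, rfl⟩
        · simp at h3
        · simp at h1 h3; exact absurd h3.1.symm h1.1
      · simp only [List.cons_append, List.cons_prefix_cons] at h3
        simp at h1 h2
        rw [ih r' m m' h1.2 h2.2 h3.2 h4, h3.1]
  have hhead : ∀ v : List A, ∃ q, applyM g v ++ [α] = α :: q := by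
    intro v
    cases v with
    | nil => exact ⟨[], by simp [applyM]⟩
    | cons b v =>
      obtain ⟨r, hr, -⟩ := hg.1 b
      exact ⟨r ++ applyM g v ++ [α], by simp [applyM_cons, hr]⟩
  intro v
  induction v with
  | nil => intro s _; exact List.nil_prefix
  | cons b v ih =>
    intro s h
    cases s with
    | nil =>
      have := h.length_le
      simp [applyM_nil] at this
    | cons d s =>
      rw [applyM_cons, applyM_cons, List.append_assoc] at h
      obtain ⟨r, hr, hrα⟩ := hg.1 b
      obtain ⟨r', hr', hrα'⟩ := hg.1 d
      have hbd : g b = g d := by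
        obtain ⟨q, hq⟩ := hhead v
        rw [hr, hr', hq] at h
        simp only [List.cons_append, List.cons_prefix_cons, true_and] at h
        rw [hr, hr', aux r r' _ _ hrα hrα' h]
        cases s with
        | nil => left; simp [applyM]
        | cons e s =>
          obtain ⟨r, hr, -⟩ := hg.1 e
          exact Or.inr ⟨r ++ applyM g s, by simp [applyM_cons, hr]⟩
      have hbd' : b = d := by
        obtain ⟨s1, h1⟩ := hg.2 b
        obtain ⟨s2, h2⟩ := hg.2 d
        rw [h1, h2] at hbd
        have := List.append_inj_right' hbd rfl
        simpa using this
      subst hbd'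
      rw [List.prefix_append_right_inj] at h
      rw [List.cons_prefix_cons]
      exact ⟨rfl, ih s h⟩

theorem good_factor (α : A) (g : A → List A) (hg : GoodG α g) (w x : ℕ → A) (hx : InfImage g w x)
    (a c : A) (v : List A) (h : IsFactorI (a :: (v ++ [c])) w) :
    IsFactorI (a :: (applyM g v ++ g c)) x := by
  refine factI_of_infix ?_ (image_factor hx h)
  obtain ⟨s, hs⟩ := hg.2 a
  refine ⟨s, [], ?_⟩
  simp [applyM_cons, applyM_append, hs, applyM_nil]

theorem good_reflect (α : A) (g : A → List A) (hg : GoodG α g) (w x : ℕ → A) (hx : InfImage g w x)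
    (hL : IsLSP x) : IsLSP w := by
  rintro v ⟨a, b, hab, ha, hb⟩
  have key : ∀ a, IsFactorI (a :: v) w → IsFactorI (a :: (applyM g v ++ [α])) x := by
    intro a ha
    obtain ⟨c, hc⟩ := factI_extend ha
    have := good_factor α g hg w x hx a c v hc
    refine factI_of_infix ?_ this
    obtain ⟨r, hr, -⟩ := hg.1 c
    rw [hr]
    exact ⟨[], r, by simp⟩
  have h1 := hL _ ⟨a, b, hab, key a ha, key b hb⟩
  have h2 := prefix_image (good_ne α g hg) hx h1
  exact prefI_of_prefix (good_decode α g hg _ _ h2) (prefI_infPrefix w _)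

theorem good_frag (α : A) (g : A → List A) (hg : GoodG α g) (w x : ℕ → A) (hx : InfImage g w x)
    (b c : A) (t : List A) (hα : g α = [α]) (hb : g b = [α, b]) (hc : g c = α :: b :: t)
    (hf : Fragile w α b c) (hbα : b ≠ α) : ¬ IsLSP x := by
  intro hL
  obtain ⟨u, β, γ, hbg, h1, h2, h3⟩ := hf
  have k2 := good_factor α g hg w x hx _ _ _ h2
  have k3 := good_factor α g hg w x hx _ _ _ h3
  rw [hb] at k2
  rw [hc] at k3
  have k3' : IsFactorI (γ :: (applyM g u ++ [α, b])) x :=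
    factI_of_infix ⟨[], t, by simp⟩ k3
  have k4 := hL _ ⟨β, γ, hbg, k2, k3'⟩
  obtain ⟨e, he⟩ := prefI_extend h1
  have k5 := image_prefix hx he
  obtain ⟨r, hr, -⟩ := hg.1 e
  have k6 : IsPrefixI (applyM g u ++ [α, α]) x := by
    refine prefI_of_prefix ?_ k5
    refine ⟨r, ?_⟩
    simp [applyM_append, applyM_cons, applyM_nil, hα, hr]
  have k7 := prefix_of_prefI k4 k6 (by simp)
  rw [List.prefix_append_right_inj] at k7
  simp at k7
  exact hbα k7

theorem good_length (α : A) (g : A → List A) (hg : GoodG α g) (v : List A)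
    (h : (applyM g v).length ≤ v.length) : ∀ b ∈ v, b = α := by
  induction v with
  | nil => simp
  | cons a v ih =>
    have h1 := applyM_length g (good_ne α g hg) v
    have h2 := List.length_pos_of_ne_nil (good_ne α g hg a)
    rw [applyM_cons] at h
    simp at h
    intro b hb
    rcases List.mem_cons.1 hb with rfl | hb
    · obtain ⟨r, hr, _⟩ := hg.1 b
      obtain ⟨s, hs⟩ := hg.2 b
      have h3 : (g b).length = 1 := by omega
      rw [hr] at h3 hs
      have : r = [] := List.eq_nil_of_length_eq_zero (by simpa using h3)
      subst this
      rcases s with _ | ⟨y, s⟩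
      · simp at hs; exact hs.symm
      · simp at hs
    · exact ih (by omega) b hb

theorem plsp_of_pow [Nonempty A] (f : A → List A) (hne : Nonerasing f) (hP : PreservesLSP f)
    (u : List A) (hp : ∀ a, ∃ k, 0 < k ∧ f a = listPow u k) : InPLSP f := by
  obtain ⟨a⟩ := ‹Nonempty A›
  obtain ⟨k, hk, hfa⟩ := hp a
  refine ⟨hne, u, ?_, hp, ?_⟩
  · rintro rfl
    apply hne a
    rw [hfa]
    apply List.eq_nil_of_length_eq_zero
    rw [listPow_length]; simp
  · intro x hx
    refine hP (fun _ => a) x ?_ ?_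
    · rw [lsp_iff]; intros; rfl
    · intro n
      have : applyM f (infPrefix (fun _ => a) n) = listPow u (k * n) := by
        induction n with
        | zero => simp [infPrefix, applyM, listPow]
        | succ n ih =>
          rw [infPrefix_succ, applyM_append, ih, applyM_cons, applyM_nil, hfa, Nat.mul_succ,
            listPow_add]
          simp
      rw [this]
      exact hx _

/-- existence of the decomposition -/
theorem common_decomp [Fintype A] [Nonempty A] (f : A → List A) (hne : Nonerasing f)
    (hP : PreservesLSP f) (α : A) (hα : ∀ a, ∃ r, f a = α :: r) :
    ∃ (g h : A → List A), GoodG α g ∧ (∀ a, f a = applyM g (h a)) ∧ Nonerasing h ∧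
      (∀ c, c ≠ α → g c = [α, c] ∨ ∃ b t, b ≠ α ∧ b ≠ c ∧ g b = [α, b] ∧ g c = α :: b :: t) ∧
      g α = [α] := by
  classical
  have hv : (Finset.univ : Finset A).toList ≠ [] := by
    simpa using Finset.univ_nonempty.ne_empty
  set v := (Finset.univ : Finset A).toList with hvd
  have hz : applyM f v ≠ [] := by
    intro h
    have := applyM_length f hne v
    rw [h] at this
    simp at this
    exact hv this
  have hL : IsLSP (per (applyM f v) hz) :=
    hP _ _ (per_nodup_lsp v hv (Finset.nodup_toList _)) (image_per f v hv hz)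
  have him := image_per f v hv hz
  have hfac : ∀ a, IsFactorI (f a) (per (applyM f v) hz) := by
    intro a
    have ha : a ∈ v := by simp [hvd]
    obtain ⟨s, t, hst⟩ := List.append_of_mem ha
    have h1 : IsPrefixI v (per v hv) := fun i hi => by rw [per_lt _ _ _ hi]; rfl
    have h2 := prefI_factI (image_prefix him h1)
    refine factI_of_infix ?_ h2
    rw [hst, applyM_append, applyM_cons]
    exact ⟨applyM f s, applyM f t, by simp⟩
  set x := per (applyM f v) hz with hx
  have hx0 : x 0 = α := by
    obtain ⟨r, hr⟩ := hα (v.head hv)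
    have h1 : IsPrefixI [v.head hv] (per v hv) := by
      intro i hi
      simp at hi; subst hi
      rw [per_lt _ _ _ (List.length_pos_of_ne_nil hv), List.head_eq_getElem]; rfl
    have h2 := image_prefix him h1
    rw [applyM_cons, hr] at h2
    exact (h2 0 (by simp)).symm
  have huniq : ∀ i j, x (i+1) = x (j+1) → x (i+1) ≠ α → x i = x j := by
    intro i j hij hi
    by_contra hn
    rw [lsp_iff] at hL
    have := hL i j 1 hn (fun k hk => by
      have : k = 0 := by omega
      subst this; exact hij) 0 (by omega)
    exact hi (by rw [← hx0]; exact this)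
  let p : A → A := fun z => if h : ∃ i, x (i+1) = z then x (Classical.choose h) else α
  have hp : ∀ i, x (i+1) ≠ α → x i = p (x (i+1)) := by
    intro i hi
    have hex : ∃ j, x (j+1) = x (i+1) := ⟨i, rfl⟩
    simp only [p, dif_pos hex]
    exact huniq _ _ (Classical.choose_spec hex).symm hi
  have hchain : ∀ a, (f a).IsChain (fun y z => z ≠ α → y = p z) := by
    intro a
    obtain ⟨k, hk⟩ := hfac a
    rw [List.isChain_iff_getElem]
    intro i hi hne
    have h1 := hk i (by omega)
    have h2 := hk (i+1) hi
    simp only [List.get_eq_getElem] at h1 h2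
    rw [h1, h2]
    rw [h2] at hne
    exact hp (k + i) hne
  let g : A → List A := fun b => if h : ∃ s, BlockS α p (s ++ [b]) then Classical.choose h ++ [b]
    else [α, b]
  have hgS : ∀ s b, BlockS α p (s ++ [b]) → g b = s ++ [b] := by
    intro s b hs
    have hex : ∃ s, BlockS α p (s ++ [b]) := ⟨s, hs⟩
    simp only [g, dif_pos hex]
    rw [block_uniq α p _ _ b (Classical.choose_spec hex) hs]
  have hgα : g α = [α] := hgS [] α ⟨⟨[], by simp, by simp⟩, by simp⟩
  have hcase : ∀ b, (BlockS α p (g b) ∧ ∃ s, g b = s ++ [b]) ∨ (g b = [α, b] ∧ b ≠ α) := by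
    intro b
    by_cases hex : ∃ s, BlockS α p (s ++ [b])
    · left
      obtain ⟨s, hs⟩ := hex
      rw [hgS s b hs]
      exact ⟨hs, s, rfl⟩
    · right
      refine ⟨by simp only [g, dif_neg hex], ?_⟩
      rintro rfl
      exact hex ⟨[], ⟨⟨[], by simp, by simp⟩, by simp⟩⟩
  have hgood : GoodG α g := by
    constructor
    · intro b
      rcases hcase b with ⟨⟨h1, -⟩, -⟩ | ⟨h, hb⟩
      · exact h1
      · exact ⟨[b], h, by simpa using hb.symm⟩
    · intro b
      rcases hcase b with ⟨-, h⟩ | ⟨h, -⟩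
      · exact h
      · exact ⟨[α], by simp [h]⟩
  have hdec : ∀ a, ∃ u, f a = applyM g u := by
    intro a
    obtain ⟨L, hL1, hL2⟩ := block_decomp α p _ (f a) le_rfl (Or.inr (hα a)) (hchain a)
    rw [hL1]
    clear hL1
    induction L with
    | nil => exact ⟨[], by simp [applyM]⟩
    | cons t L ih =>
      obtain ⟨u, hu⟩ := ih (fun t ht => hL2 t (List.mem_cons_of_mem _ ht))
      have ht := hL2 t List.mem_cons_self
      have htn : t ≠ [] := by
        obtain ⟨⟨r, hr, -⟩, -⟩ := ht
        simp [hr]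
      obtain ⟨s, b, rfl⟩ : ∃ s b, t = s ++ [b] := ⟨_, _, (List.dropLast_append_getLast htn).symm⟩
      exact ⟨b :: u, by rw [applyM_cons, hgS s b ht, List.flatten_cons, hu]⟩
  choose h hh using hdec
  refine ⟨g, h, hgood, hh, ?_, ?_, hgα⟩
  · intro a ha
    apply hne a
    rw [hh, ha, applyM_nil]
  · intro c hc
    rcases hcase c with ⟨⟨⟨r, hr, hrα⟩, hch⟩, ⟨s, hs⟩⟩ | ⟨h, -⟩
    swap
    · exact Or.inl h
    match r, hr, hrα with
    | [], hr, _ =>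
      exfalso
      rw [hr] at hs
      rcases s with _ | ⟨y, s⟩
      · simp at hs; exact hc hs.symm
      · simp at hs
    | [b], hr, _ =>
      left
      rw [hr] at hs ⊢
      have : [α] ++ [b] = s ++ [c] := by simpa using hs
      have := List.append_inj_right' this rfl
      simpa using this
    | b :: b' :: t, hr, hrα =>
      right
      have hbα : b ≠ α := by
        rintro rfl; simp at hrα
      have hb : g b = [α, b] := by
        refine hgS [α] b ⟨⟨[b], rfl, by simpa using hbα.symm⟩, ?_⟩
        rw [hr] at hch
        have : ([α, b] ++ (b' :: t)).IsChain (fun y z => z ≠ α → y = p z) := by simpa using hch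
        exact this.left_of_append
      refine ⟨b, b' :: t, hbα, ?_, hb, hr⟩
      rintro rfl
      rw [hr] at hb
      simp at hb

end Common

theorem main_forward {A : Type*} [Fintype A] [DecidableEq A] : ∀ (n : ℕ) (f : A → List A)
    (hne : Nonerasing f) (hP : PreservesLSP f), (∑ a, (f a).length) ≤ n →
      ((∃ (l : List A) (σ : Equiv.Perm A),
          ∀ a : A, f a = l.foldr (fun α v => applyM (Lmor α) v) [σ a]) ∨
        InPLSP f) := by
  intro n
  induction n using Nat.strong_induction_on with
  | _ n ih =>
  intro f hne hP hn
  by_cases hh : ∃ a b, (f a).head (hne a) ≠ (f b).head (hne b)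
  · obtain ⟨σ, hσ⟩ := heads_perm f hne hP hh
    exact Or.inl ⟨[], σ, by simpa using hσ⟩
  push Not at hh
  rcases isEmpty_or_nonempty A with hA | hA
  · exact Or.inl ⟨[], Equiv.refl A, fun a => (hA.false a).elim⟩
  obtain ⟨a0⟩ := id hA
  set α := (f a0).head (hne a0) with hαd
  have hα : ∀ a, ∃ r, f a = α :: r := by
    intro a
    refine ⟨(f a).tail, ?_⟩
    rw [hαd, ← hh a a0, List.cons_head_tail]
  obtain ⟨g, h, hg, hf, hhne, hgc, hgα⟩ := common_decomp f hne hP α hα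
  have hf' : f = fun a => applyM g (h a) := funext hf
  have hhP : PreservesLSP h := by
    intro w y hw hy
    obtain ⟨x, hx⟩ := exists_image g (good_ne α g hg) y
    refine good_reflect α g hg y x hx (hP w x hw ?_)
    rw [hf']
    exact image_comp hy hx
  have hle : ∀ a, (h a).length ≤ (f a).length := fun a => by
    rw [hf]; exact applyM_length g (good_ne α g hg) _
  by_cases hall : ∀ a, (f a).length ≤ (h a).length
  · right
    refine plsp_of_pow f hne hP [α] ?_
    intro a
    have h1 := good_length α g hg (h a) (by rw [← hf]; exact hall a)
    have h2 : h a = List.replicate (h a).length α := List.eq_replicate_of_mem h1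
    refine ⟨(h a).length, List.length_pos_of_ne_nil (hhne a), ?_⟩
    have h3 : ∀ k, applyM g (List.replicate k α) = listPow [α] k := by
      intro k
      induction k with
      | zero => simp [applyM, listPow]
      | succ k ih => rw [List.replicate_succ, applyM_cons, ih, hgα, listPow_succ]
    rw [hf]
    conv_lhs => rw [h2]
    exact h3 _
  push Not at hall
  obtain ⟨a1, ha1⟩ := hall
  have hlt : (∑ a, (h a).length) < ∑ a, (f a).length :=
    Finset.sum_lt_sum (fun a _ => hle a) ⟨a1, Finset.mem_univ _, ha1⟩
  rcases ih _ (lt_of_lt_of_le hlt hn) h hhne hhP le_rfl with ⟨l, σ, hl⟩ | hpl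
  · left
    have hhl : h = fun a => l.foldr (fun α v => applyM (Lmor α) v) [σ a] := funext hl
    have hgL : g = Lmor α := by
      funext c
      by_cases hc : c = α
      · subst hc; rw [hgα]; simp [Lmor]
      · rcases hgc c hc with h1 | ⟨b, t, hb, hbc, hgb, hgc'⟩
        · rw [h1]; simp [Lmor, hc]
        · exfalso
          obtain ⟨w, y, hw, hy, hfr⟩ := chain_frag l σ α b c hb.symm (Ne.symm hc) hbc
          obtain ⟨x, hx⟩ := exists_image g (good_ne α g hg) y
          refine good_frag α g hg y x hx b c t hgα hgb hgc' hfr hb (hP w x hw ?_)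
          rw [hf', hhl]
          exact image_comp hy hx
    refine ⟨α :: l, σ, ?_⟩
    intro a
    rw [hf, hl, hgL]
    rfl
  · right
    obtain ⟨-, u, hu, hp, -⟩ := hpl
    refine plsp_of_pow f hne hP (applyM g u) ?_
    intro a
    obtain ⟨k, hk, hka⟩ := hp a
    exact ⟨k, hk, by rw [hf, hka, applyM_listPow]⟩


/-- a nonerasing endomorphism preserves the LSP property iff it
belongs to `𝓛* Perm ∪ P_LSP`. -/
theorem preserving_endomorphism_charac {A : Type*} [Fintype A] [DecidableEq A]
    (f : A → List A) (hne : Nonerasing f) :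
    PreservesLSP f ↔
      ((∃ (l : List A) (σ : Equiv.Perm A),
          ∀ a : A, f a = l.foldr (fun α v => applyM (Lmor α) v) [σ a]) ∨
        InPLSP f) := by
  constructor
  · intro hP
    exact main_forward _ f hne hP le_rfl
  · rintro (⟨l, σ, hl⟩ | hpl)
    · rw [funext hl]
      exact chain_preserves l σ σ.injective
    · exact plsp_preserves f hpl
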